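/- arXiv:0909.3002 — 2 statements merged into one kernel-verified Lean document; each statement's English description precedes it below -/
import Mathlib

section
/- Let N ≥ 3 be an integer and let a, b be integers with 1 ≤ a ≤ N−1, 1 ≤ b ≤ N−1 and a+b ≠ N. Then the real number F̃(a/N, b/N) − F̃((N−a)/N, (N−b)/N) is nonzero; it is positive if a+b < N and negative if a+b > N. -/
/-- Pochhammer symbol (α, n) = α(α+1)⋯(α+n-1). -/
noncomputable def poch (α : ℝ) (n : ℕ) : ℝ := ∏ i ∈ Finset.range n, (α + i)

/-- F̃(α,β) = (Γ(α)Γ(β)/Γ(α+β+1)) · Σ_{m,n≥0} (α,m)(β,n)/(α+β+1, m+n). -/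
noncomputable def Ftilde (α β : ℝ) : ℝ :=
  (Real.Gamma α * Real.Gamma β / Real.Gamma (α + β + 1)) *
    ∑' p : ℕ × ℕ, poch α p.1 * poch β p.2 / poch (α + β + 1) (p.1 + p.2)

lemma poch_pos {x : ℝ} (hx : 0 < x) (n : ℕ) : 0 < poch x n :=
  Finset.prod_pos fun i _ => by positivity

lemma poch_succ (x : ℝ) (n : ℕ) : poch x (n + 1) = poch x n * (x + n) :=
  Finset.prod_range_succ _ _

lemma poch_add (x : ℝ) (m n : ℕ) : poch x (m + n) = poch x m * poch (x + m) n := by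
  simp only [poch, Finset.prod_range_add, Nat.cast_add, add_assoc]

lemma Gamma_mul_poch {x : ℝ} (hx : 0 < x) (n : ℕ) :
    Real.Gamma x * poch x n = Real.Gamma (x + n) := by
  induction n with
  | zero => simp [poch]
  | succ n ih =>
    rw [poch_succ, ← mul_assoc, ih, Nat.cast_succ, ← add_assoc,
      Real.Gamma_add_one (by positivity), mul_comm]

/-- The value `Γ(x)Γ(y)/Γ(x+y+1)` of the Dirichlet integral of `s^(x-1) t^(y-1)` over the
standard triangle. -/
noncomputable def dirichletGamma (x y : ℝ) : ℝ :=
  Real.Gamma x * Real.Gamma y / Real.Gamma (x + y + 1)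

lemma dirichletGamma_comm (x y : ℝ) : dirichletGamma x y = dirichletGamma y x := by
  simp only [dirichletGamma, mul_comm, add_comm]

lemma dirichletGamma_pos {x y : ℝ} (hx : 0 < x) (hy : 0 < y) : 0 < dirichletGamma x y :=
  div_pos (mul_pos (Real.Gamma_pos_of_pos hx) (Real.Gamma_pos_of_pos hy))
    (Real.Gamma_pos_of_pos (by positivity))

lemma Gamma_mul_Gamma_add_le {x x' h : ℝ} (hx : 0 < x) (hxx' : x < x') (hh : 0 < h) :
    Real.Gamma x' * Real.Gamma (x + h) ≤ Real.Gamma x * Real.Gamma (x' + h) := by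
  have hd : 0 < x' - x + h := by linarith
  have hx' : 0 < x' := hx.trans hxx'
  have hl : 0 ≤ h / (x' - x + h) := by positivity
  have hr : 0 ≤ (x' - x) / (x' - x + h) := div_nonneg (by linarith) hd.le
  have hs : h / (x' - x + h) + (x' - x) / (x' - x + h) = 1 := by field_simp; ring
  have hxm : x ∈ Set.Ioi (0 : ℝ) := hx
  have hym : x' + h ∈ Set.Ioi (0 : ℝ) := Set.mem_Ioi.2 (by positivity)
  have h1 := Real.convexOn_log_Gamma.2 hxm hym hl hr hs
  have h2 := Real.convexOn_log_Gamma.2 hxm hym hr hl ((add_comm _ _).trans hs)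
  have e1 : (h / (x' - x + h)) • x + ((x' - x) / (x' - x + h)) • (x' + h) = x' := by
    simp only [smul_eq_mul]; field_simp; ring
  have e2 : ((x' - x) / (x' - x + h)) • x + (h / (x' - x + h)) • (x' + h) = x + h := by
    simp only [smul_eq_mul]; field_simp; ring
  rw [e1] at h1
  rw [e2] at h2
  simp only [Function.comp_apply, smul_eq_mul] at h1 h2
  have g1 := Real.Gamma_pos_of_pos hx
  have g2 := Real.Gamma_pos_of_pos hx'
  have g3 := Real.Gamma_pos_of_pos (add_pos hx hh)
  have g4 := Real.Gamma_pos_of_pos (add_pos hx' hh)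
  rw [← Real.log_le_log_iff (by positivity) (by positivity), Real.log_mul g2.ne' g3.ne',
    Real.log_mul g1.ne' g4.ne']
  linear_combination h1 + h2 +
    (Real.log (Real.Gamma x) + Real.log (Real.Gamma (x' + h))) * hs

lemma dirichletGamma_lt_left {x x' y : ℝ} (hx : 0 < x) (hxx' : x < x') (hy : 0 < y) :
    dirichletGamma x' y < dirichletGamma x y := by
  have hx' : 0 < x' := hx.trans hxx'
  have key := Gamma_mul_Gamma_add_le hx hxx' hy
  have g1 := Real.Gamma_pos_of_pos hx
  have g3 := Real.Gamma_pos_of_pos (add_pos hx hy)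
  have g4 := Real.Gamma_pos_of_pos (add_pos hx' hy)
  have gy := Real.Gamma_pos_of_pos hy
  rw [dirichletGamma, dirichletGamma, Real.Gamma_add_one (by positivity),
    Real.Gamma_add_one (by positivity), div_lt_div_iff₀ (by positivity) (by positivity)]
  calc Real.Gamma x' * Real.Gamma y * ((x + y) * Real.Gamma (x + y))
      = Real.Gamma y * (x + y) * (Real.Gamma x' * Real.Gamma (x + y)) := by ring
    _ ≤ Real.Gamma y * (x + y) * (Real.Gamma x * Real.Gamma (x' + y)) := by gcongr
    _ < Real.Gamma y * (x' + y) * (Real.Gamma x * Real.Gamma (x' + y)) := by gcongr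
    _ = Real.Gamma x * Real.Gamma y * ((x' + y) * Real.Gamma (x' + y)) := by ring

lemma dirichletGamma_lt {x x' y y' : ℝ} (hx : 0 < x) (hxx' : x < x') (hy : 0 < y)
    (hyy' : y < y') : dirichletGamma x' y' < dirichletGamma x y := by
  refine (dirichletGamma_lt_left hx hxx' (hy.trans hyy')).trans ?_
  rw [dirichletGamma_comm x y', dirichletGamma_comm x y]
  exact dirichletGamma_lt_left hy hyy' hx

lemma sum_range_poch_div_le {x d : ℝ} (hx : 0 < x) (hd : 0 < d) (n : ℕ) :
    ∑ m ∈ Finset.range n, poch x m / poch (x + d) (m + 1) ≤ 1 / d := by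
  have telescope : ∑ m ∈ Finset.range n, poch x m / poch (x + d) (m + 1) =
      (1 - poch x n / poch (x + d) n) / d := by
    induction n with
    | zero => simp [poch]
    | succ n ih =>
      have hp := poch_pos (add_pos hx hd) n
      have hn : 0 < x + d + n := by positivity
      rw [Finset.sum_range_succ, ih, poch_succ, poch_succ]
      field_simp
      ring
  rw [telescope]
  gcongr
  have := poch_pos hx n
  have := poch_pos (add_pos hx hd) n
  linarith [div_pos ‹0 < poch x n› this]

lemma poch_div_nonneg {x d : ℝ} (hx : 0 < x) (hd : 0 < d) (m : ℕ) :
    0 ≤ poch x m / poch (x + d) (m + 1) :=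
  (div_pos (poch_pos hx _) (poch_pos (add_pos hx hd) _)).le

lemma summable_poch_div {x d : ℝ} (hx : 0 < x) (hd : 0 < d) :
    Summable fun m : ℕ => poch x m / poch (x + d) (m + 1) :=
  summable_of_sum_range_le (poch_div_nonneg hx hd) (sum_range_poch_div_le hx hd)

lemma tsum_poch_div_le {x d : ℝ} (hx : 0 < x) (hd : 0 < d) :
    ∑' m : ℕ, poch x m / poch (x + d) (m + 1) ≤ 1 / d :=
  Real.tsum_le_of_sum_range_le (poch_div_nonneg hx hd) (sum_range_poch_div_le hx hd)

lemma summable_poch_mul_poch_div {α β : ℝ} (hα : 0 < α) (hβ : 0 < β) :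
    Summable fun p : ℕ × ℕ => poch α p.1 * poch β p.2 / poch (α + β + 1) (p.1 + p.2) := by
  have factor (m n : ℕ) : poch α n * poch β m / poch (α + β + 1) (n + m) =
      (α + β) * (poch β m / poch (α + β) m) *
        (poch α n / poch (α + (β + m)) (n + 1)) := by
    have e1 : poch (α + β) (m + (n + 1)) = (α + β) * poch (α + β + 1) (n + m) := by
      rw [show m + (n + 1) = 1 + (n + m) by ring, poch_add]
      simp [poch]
    rw [poch_add, add_assoc α β (m : ℝ)] at e1
    have h1 := poch_pos (show 0 < α + β by positivity) m
    have h2 := poch_pos (show 0 < α + (β + m) by positivity) (n + 1)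
    have h3 := poch_pos (show 0 < α + β + 1 by positivity) (n + m)
    field_simp
    linear_combination (poch α n * poch β m) * e1
  rw [← (Equiv.prodComm ℕ ℕ).summable_iff]
  refine (summable_prod_of_nonneg ?_).2 ⟨fun m => ?_, ?_⟩
  · intro p
    have h1 := poch_pos hα p.2
    have h2 := poch_pos hβ p.1
    have h3 := poch_pos (show 0 < α + β + 1 by positivity) (p.2 + p.1)
    simp only [Pi.zero_apply, Function.comp_apply, Equiv.prodComm_apply, Prod.fst_swap,
      Prod.snd_swap]
    positivity
  · simp only [Function.comp_apply, Equiv.prodComm_apply, Prod.swap_prod_mk, factor]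
    exact (summable_poch_div hα (by positivity)).mul_left _
  · simp only [Function.comp_apply, Equiv.prodComm_apply, Prod.swap_prod_mk, factor,
      tsum_mul_left]
    refine Summable.of_nonneg_of_le (fun m => ?_) (fun m => ?_)
      ((summable_poch_div hβ hα).mul_left ((α + β) * ((α + β) / β)))
    · have h1 := poch_pos hβ m
      have h2 := poch_pos (add_pos hα hβ) m
      have := tsum_nonneg (L := .unconditional ℕ)
        (poch_div_nonneg hα (show 0 < β + (m : ℝ) by positivity))
      positivity
    · have h1 := poch_pos hβ m
      have h2 := poch_pos (add_pos hα hβ) m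
      have hm : 0 < β + (m : ℝ) := by positivity
      have hm' : 0 < α + β + (m : ℝ) := by positivity
      calc _ ≤ (α + β) * (poch β m / poch (α + β) m) * (1 / (β + m)) := by
            gcongr
            exact tsum_poch_div_le hα hm
        _ ≤ (α + β) * (poch β m / poch (α + β) m) *
              ((α + β) / β * (1 / (α + β + m))) := by
            gcongr
            rw [div_mul_div_comm, div_le_div_iff₀ hm (by positivity)]
            nlinarith [mul_nonneg hα.le (Nat.cast_nonneg (α := ℝ) m)]
        _ = _ := by
            rw [add_comm β α, poch_succ]
            field_simp

lemma Gamma_div_mul_poch {α β : ℝ} (hα : 0 < α) (hβ : 0 < β) (m n : ℕ) :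
    (Real.Gamma α * Real.Gamma β / Real.Gamma (α + β + 1)) *
      (poch α m * poch β n / poch (α + β + 1) (m + n)) = dirichletGamma (α + m) (β + n) := by
  rw [dirichletGamma, ← Gamma_mul_poch hα, ← Gamma_mul_poch hβ,
    show α + m + (β + n) + 1 = α + β + 1 + ((m + n : ℕ) : ℝ) by push_cast; ring,
    ← Gamma_mul_poch (by positivity), div_mul_div_comm]
  congr 1
  ring

lemma Ftilde_eq_tsum {α β : ℝ} (hα : 0 < α) (hβ : 0 < β) :
    Ftilde α β = ∑' p : ℕ × ℕ, dirichletGamma (α + p.1) (β + p.2) := by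
  simp only [Ftilde, ← tsum_mul_left, Gamma_div_mul_poch hα hβ]

lemma summable_dirichletGamma {α β : ℝ} (hα : 0 < α) (hβ : 0 < β) :
    Summable fun p : ℕ × ℕ => dirichletGamma (α + p.1) (β + p.2) := by
  simpa only [Gamma_div_mul_poch hα hβ] using (summable_poch_mul_poch_div hα hβ).mul_left
    (Real.Gamma α * Real.Gamma β / Real.Gamma (α + β + 1))

lemma Ftilde_comm {α β : ℝ} (hα : 0 < α) (hβ : 0 < β) : Ftilde α β = Ftilde β α := by
  rw [Ftilde_eq_tsum hα hβ, Ftilde_eq_tsum hβ hα, ← (Equiv.prodComm ℕ ℕ).tsum_eq]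
  simp only [Equiv.prodComm_apply, Prod.fst_swap, Prod.snd_swap]
  exact tsum_congr fun p => dirichletGamma_comm _ _

lemma Ftilde_lt {α α' β β' : ℝ} (hα : 0 < α) (hαα' : α < α') (hβ : 0 < β) (hββ' : β < β') :
    Ftilde α' β' < Ftilde α β := by
  have hα' := hα.trans hαα'
  have hβ' := hβ.trans hββ'
  have lt (p : ℕ × ℕ) : dirichletGamma (α' + p.1) (β' + p.2) <
      dirichletGamma (α + p.1) (β + p.2) :=
    dirichletGamma_lt (by positivity) (by gcongr) (by positivity) (by gcongr)
  rw [Ftilde_eq_tsum hα' hβ', Ftilde_eq_tsum hα hβ]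
  exact Summable.tsum_lt_tsum (fun p => (lt p).le) (lt (0, 0))
    (summable_dirichletGamma hα' hβ') (summable_dirichletGamma hα hβ)

lemma Ftilde_one_sub_lt {α β : ℝ} (hα : 0 < α) (hβ : 0 < β) (h : α + β < 1) :
    Ftilde (1 - α) (1 - β) < Ftilde α β := by
  rw [Ftilde_comm (by linarith) (by linarith)]
  exact Ftilde_lt hα (by linarith) hβ (by linarith)

theorem stmt4 (N : ℕ) (hN : 3 ≤ N) (a b : ℤ) (ha0 : 1 ≤ a) (ha1 : a ≤ (N : ℤ) - 1)
    (hb0 : 1 ≤ b) (hb1 : b ≤ (N : ℤ) - 1) (hab : a + b ≠ (N : ℤ)) :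
    (Ftilde ((a : ℝ) / N) ((b : ℝ) / N) -
        Ftilde (((N : ℝ) - a) / N) (((N : ℝ) - b) / N) ≠ 0) ∧
    (a + b < (N : ℤ) →
      0 < Ftilde ((a : ℝ) / N) ((b : ℝ) / N) -
        Ftilde (((N : ℝ) - a) / N) (((N : ℝ) - b) / N)) ∧
    ((N : ℤ) < a + b →
      Ftilde ((a : ℝ) / N) ((b : ℝ) / N) -
        Ftilde (((N : ℝ) - a) / N) (((N : ℝ) - b) / N) < 0) := by
  have hNpos : (0 : ℝ) < N := by exact_mod_cast (by omega : 0 < N)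
  have ha : (0 : ℝ) < a := by exact_mod_cast ha0
  have hb : (0 : ℝ) < b := by exact_mod_cast hb0
  have ha' : (a : ℝ) < N := by exact_mod_cast (by omega : a < (N : ℤ))
  have hb' : (b : ℝ) < N := by exact_mod_cast (by omega : b < (N : ℤ))
  rw [sub_div, sub_div, div_self hNpos.ne']
  have hα : (a : ℝ) / N < 1 := (div_lt_one hNpos).2 ha'
  have hβ : (b : ℝ) / N < 1 := (div_lt_one hNpos).2 hb'
  have pos (h : a + b < (N : ℤ)) : 0 < Ftilde ((a : ℝ) / N) ((b : ℝ) / N) -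
      Ftilde (1 - (a : ℝ) / N) (1 - (b : ℝ) / N) := by
    refine sub_pos.2 (Ftilde_one_sub_lt (by positivity) (by positivity) ?_)
    rw [← add_div, div_lt_one hNpos]
    exact_mod_cast h
  have neg (h : (N : ℤ) < a + b) : Ftilde ((a : ℝ) / N) ((b : ℝ) / N) -
      Ftilde (1 - (a : ℝ) / N) (1 - (b : ℝ) / N) < 0 := by
    have hsum : 1 < (a : ℝ) / N + (b : ℝ) / N := by
      rw [← add_div, one_lt_div hNpos]
      exact_mod_cast h
    have := Ftilde_one_sub_lt (sub_pos.2 hα) (sub_pos.2 hβ) (by linarith)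
    rw [sub_sub_cancel, sub_sub_cancel] at this
    exact sub_neg.2 this
  exact ⟨hab.lt_or_gt.elim (fun h => (pos h).ne') fun h => (neg h).ne, pos, neg⟩
end

section
/- Let K be a finite field with q elements, N a positive integer dividing q−1, ζ ∈ K an element of multiplicative order exactly N, and k̄ a fixed algebraic closure of K. Fix n ≥ 1 and an integer t. Then the number of elements w ∈ k̄ with w ≠ 0, w^N = −1 and w^{q^n} = ζ^t·w equals N if (−1)^{(q^n−1)/N} = ζ^t, and 0 otherwise. -/
/-- In an algebraically closed field containing a primitive `N`-th root of unity, a nonzero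
element has exactly `N` distinct `N`-th roots. -/
theorem IsPrimitiveRoot.ncard_setOf_pow_eq {F : Type*} [Field F] [IsAlgClosed F] {N : ℕ}
    (hN : 0 < N) {z : F} (hz : IsPrimitiveRoot z N) {a : F} (ha : a ≠ 0) :
    Set.ncard {w : F | w ^ N = a} = N := by
  classical
  have hset : {w : F | w ^ N = a} = ((Polynomial.nthRoots N a).toFinset : Set F) := by
    ext w
    simp [Polynomial.mem_nthRoots hN]
  rw [hset, Set.ncard_coe_finset, Multiset.toFinset_card_of_nodup (hz.nthRoots_nodup ha),
    hz.card_nthRoots, if_pos (IsAlgClosed.exists_pow_nat_eq a hN)]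

/-- If `w ^ N = a` and `N ∣ Q - 1`, raising `w` to the power `Q` multiplies it by a power of `a`. -/
theorem pow_eq_pow_div_mul {M : Type*} [Monoid M] {N Q : ℕ} (hQ : 0 < Q) (hNQ : N ∣ Q - 1)
    {w a : M} (hw : w ^ N = a) : w ^ Q = a ^ ((Q - 1) / N) * w := by
  rw [← hw, ← pow_mul, Nat.mul_div_cancel' hNQ, ← pow_succ, Nat.sub_add_cancel hQ]

open scoped Classical in
theorem stmt14 (K kbar : Type*) [Field K] [Fintype K] [Field kbar] [Algebra K kbar]
    [IsAlgClosure K kbar]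
    (q N : ℕ) (hq : Fintype.card K = q) (hN : 0 < N) (hNq : N ∣ q - 1)
    (ζ : K) (hζ : orderOf ζ = N)
    (n : ℕ) (hn : 1 ≤ n) (t : ℤ) :
    Set.ncard {w : kbar |
        w ≠ 0 ∧ w ^ N = -1 ∧ w ^ q ^ n = algebraMap K kbar ζ ^ t * w} =
      if (-1 : kbar) ^ ((q ^ n - 1) / N) = algebraMap K kbar ζ ^ t then N else 0 := by
  have : IsAlgClosed kbar := IsAlgClosure.isAlgClosed K
  have hq0 : 0 < q := hq ▸ Fintype.card_pos
  have hdvd : N ∣ q ^ n - 1 := hNq.trans (by simpa using Nat.sub_dvd_pow_sub_pow q 1 n)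
  have hz : IsPrimitiveRoot (algebraMap K kbar ζ) N :=
    (hζ ▸ IsPrimitiveRoot.orderOf ζ).map_of_injective (algebraMap K kbar).injective
  have hne : ∀ w : kbar, w ^ N = -1 → w ≠ 0 := by
    rintro w hw rfl
    simp [hN.ne'] at hw
  have hpow : ∀ w : kbar, w ^ N = -1 → (w ^ q ^ n = algebraMap K kbar ζ ^ t * w ↔
      (-1 : kbar) ^ ((q ^ n - 1) / N) = algebraMap K kbar ζ ^ t) := fun w hw => by
    rw [pow_eq_pow_div_mul (pow_pos hq0 n) hdvd hw, mul_left_inj' (hne w hw)]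
  split_ifs with h
  · refine Eq.trans (congrArg Set.ncard (Set.ext fun w => ?_))
      (hz.ncard_setOf_pow_eq hN (neg_ne_zero.mpr one_ne_zero))
    exact ⟨fun hw => hw.2.1, fun hw => ⟨hne w hw, hw, (hpow w hw).mpr h⟩⟩
  · refine Eq.trans (congrArg Set.ncard (Set.eq_empty_of_forall_notMem fun w hw => ?_))
      (Set.ncard_empty kbar)
    exact h ((hpow w hw.2.1).mp hw.2.2)
end
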